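/- Let q be prime and let A be a transitive subgroup of S_q. Then either A is permutation-isomorphic to a subgroup of the group AGL(1,q) of affine linear transformations x ↦ ax+b of 𝔽_q (with a ≠ 0), or A is doubly transitive and contains a normal subgroup that is nonabelian and simple. -/

import Mathlib

open Polynomial

noncomputable def Nop {p : ℕ} (U : Finset (ZMod p)) (f : (ZMod p)[X]) : (ZMod p)[X] :=
  ∑ u ∈ U, (taylor u f - f)

lemma Nop_coeff {p : ℕ} [Fact p.Prime] (U : Finset (ZMod p)) (f : (ZMod p)[X]) (j : ℕ)
    (hf : f.natDegree < p) :
    (Nop U f).coeff j =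
      ∑ k ∈ Finset.range p, (if k = 0 then 0 else ((k + j).choose j : ZMod p) * f.coeff (k + j) * ∑ u ∈ U, u ^ k) := by
  have hd : ∀ u : ZMod p, (taylor u f - f).coeff j =
      ∑ k ∈ Finset.range p, (if k = 0 then 0 else ((k + j).choose j : ZMod p) * f.coeff (k + j) * u ^ k) := by
    intro u
    obtain ⟨r, rfl⟩ : ∃ r, p = r + 1 := ⟨p - 1, by have := (Fact.out : p.Prime).pos; omega⟩
    rw [coeff_sub, taylor_coeff, eval_eq_sum_range' (n := r + 1)]
    · rw [Finset.sum_range_succ', Finset.sum_range_succ']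
      simp [hasseDeriv_coeff]
    · have := natDegree_hasseDeriv_le f j
      omega
  rw [Nop, finsetSum_coeff, Finset.sum_congr rfl (fun u _ => hd u), Finset.sum_comm]
  refine Finset.sum_congr rfl fun k _ => ?_
  split_ifs
  · simp
  · rw [Finset.mul_sum]

lemma Nop_eval {p : ℕ} (U : Finset (ZMod p)) (f : (ZMod p)[X]) (x : ZMod p) :
    (Nop U f).eval x = ∑ u ∈ U, (f.eval (x + u) - f.eval x) := by
  simp [Nop, eval_finsetSum, taylor_eval]

lemma Nop_natDegree {p : ℕ} [Fact p.Prime] (U : Finset (ZMod p)) (f : (ZMod p)[X])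
    (hf : f.natDegree < p) : (Nop U f).natDegree < p := by
  refine lt_of_le_of_lt (natDegree_sum_le_of_forall_le (n := f.natDegree) _ _ fun u _ => ?_) hf
  refine (natDegree_sub_le _ _).trans ?_
  simp [natDegree_taylor]

lemma Nop_lead {p : ℕ} [Fact p.Prime] (U : Finset (ZMod p)) (m : ℕ) (hm : 1 ≤ m)
    (hmin : ∀ k, 1 ≤ k → k < m → ∑ u ∈ U, u ^ k = 0) (hmm : ∑ u ∈ U, u ^ m ≠ 0)
    (f : (ZMod p)[X]) (hf : f.natDegree < p) (hmf : m ≤ f.natDegree) :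
    (Nop U f).coeff (f.natDegree - m) ≠ 0 := by
  rw [Nop_coeff U f _ hf, Finset.sum_eq_single m]
  · rw [if_neg (by omega), Nat.add_sub_cancel' hmf]
    refine mul_ne_zero (mul_ne_zero ?_ ?_) hmm
    · rw [Ne, ZMod.natCast_eq_zero_iff]
      intro h
      have h2 : p ∣ f.natDegree.factorial := by
        rw [← Nat.choose_mul_factorial_mul_factorial (Nat.sub_le f.natDegree m)]
        exact Dvd.dvd.mul_right (Dvd.dvd.mul_right h _) _
      have := ((Fact.out : p.Prime).dvd_factorial).1 h2
      omega
    · rw [coeff_natDegree, Ne, leadingCoeff_eq_zero]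
      rintro rfl
      simp at hmf; omega
  · intro k _ hk
    split_ifs with h0
    · rfl
    · rcases lt_or_gt_of_ne hk with h | h
      · rw [hmin k (by omega) h, mul_zero]
      · rw [coeff_eq_zero_of_natDegree_lt (by omega)]; simp
  · intro h; simp at h; omega

lemma poly_eq {p : ℕ} [Fact p.Prime] (f g : (ZMod p)[X])
    (hf : f.natDegree < p) (hg : g.natDegree < p) (h : ∀ x, f.eval x = g.eval x) : f = g := by
  refine eq_of_degree_sub_lt_of_eval_finset_eq Finset.univ ?_ (fun x _ => h x)
  refine lt_of_le_of_lt degree_le_natDegree ?_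
  rw [Finset.card_univ, ZMod.card]
  exact_mod_cast lt_of_le_of_lt (natDegree_sub_le f g) (max_lt hf hg)

lemma exists_power {p : ℕ} [Fact p.Prime] (U : Finset (ZMod p)) (h0 : 0 ∉ U) (hne : U.Nonempty) :
    ∃ k, (1 ≤ k ∧ k ≤ U.card) ∧ ∑ u ∈ U, u ^ k ≠ 0 := by
  by_contra! hcon
  obtain ⟨u0, hu0⟩ := hne
  set g : (ZMod p)[X] := ∏ v ∈ U.erase u0, (X - C v) with hg
  have hdeg : g.natDegree < U.card := by
    rw [hg, natDegree_finsetProd_X_sub_C_eq_card, Finset.card_erase_of_mem hu0]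
    have := Finset.card_pos.2 ⟨u0, hu0⟩
    omega
  have h1 : ∑ u ∈ U, u * g.eval u = 0 := by
    simp_rw [eval_eq_sum_range' hdeg, Finset.mul_sum]
    rw [Finset.sum_comm]
    refine Finset.sum_eq_zero fun k hk => ?_
    have := hcon (k + 1) ⟨by omega, by simpa using hk⟩
    calc _ = ∑ u ∈ U, g.coeff k * u ^ (k+1) := Finset.sum_congr rfl fun u _ => by ring
      _ = 0 := by rw [← Finset.mul_sum, this, mul_zero]
  rw [Finset.sum_eq_single u0] at h1
  · rcases mul_eq_zero.1 h1 with h | h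
    · exact h0 (h ▸ hu0)
    · rw [hg, eval_prod, Finset.prod_eq_zero_iff] at h
      obtain ⟨v, hv, hv2⟩ := h
      simp [sub_eq_zero] at hv2
      simp [hv2] at hv
  · intro v hv hvu
    rw [hg, eval_prod, Finset.prod_eq_zero (i := v)]
    · simp
    · simp [hv, hvu]
    · simp
  · intro h; exact absurd hu0 h

lemma burn1 {p : ℕ} [Fact p.Prime] (U : Finset (ZMod p)) (h0 : 0 ∉ U) (hne : U.Nonempty)
    (hc : 2 * U.card < p) (π : Equiv.Perm (ZMod p))
    (h : ∀ i j, i - j ∈ U ↔ π i - π j ∈ U) : ∃ a b, ∀ x, π x = a * x + b := by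
  classical
  have hp : p.Prime := Fact.out
  have hex := exists_power U h0 hne
  obtain ⟨m, ⟨⟨hm1, hmU⟩, hmm⟩, hmin'⟩ : ∃ m, ((1 ≤ m ∧ m ≤ U.card) ∧ ∑ u ∈ U, u ^ m ≠ 0) ∧
      ∀ k < m, ¬ ((1 ≤ k ∧ k ≤ U.card) ∧ ∑ u ∈ U, u ^ k ≠ 0) :=
    ⟨Nat.find hex, Nat.find_spec hex, fun k hk => Nat.find_min hex hk⟩
  have hmin : ∀ k, 1 ≤ k → k < m → ∑ u ∈ U, u ^ k = 0 := by
    intro k h1 h2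
    by_contra h3
    exact hmin' k h2 ⟨⟨h1, by omega⟩, h3⟩
  obtain ⟨P, hPd, hP⟩ : ∃ P : (ZMod p)[X], P.natDegree < p ∧ ∀ x, P.eval x = π x := by
    refine ⟨Lagrange.interpolate Finset.univ id π, ?_, fun x => ?_⟩
    · have := Lagrange.degree_interpolate_lt (s := (Finset.univ : Finset (ZMod p))) (v := id) π
        (Function.injective_id.injOn)
      rw [Finset.card_univ, ZMod.card] at this
      by_cases hz : Lagrange.interpolate Finset.univ id π = 0
      · rw [hz]; simpa using hp.pos
      · exact (natDegree_lt_iff_degree_lt hz).2 this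
    · exact Lagrange.eval_interpolate_at_node (v := id) π (Function.injective_id.injOn) (Finset.mem_univ x)
  have key : ∀ k x, (Nop U (P ^ k)).eval x = (Nop U (X ^ k)).eval (π x) := by
    intro k x
    rw [Nop_eval, Nop_eval]
    refine Finset.sum_bij (fun u _ => π (x + u) - π x) ?_ ?_ ?_ ?_
    · intro u hu
      rw [← h]; simpa using hu
    · intro u _ v _ huv
      simpa using huv
    · intro v hv
      refine ⟨π.symm (π x + v) - x, ?_, by simp⟩
      rw [h]; simpa using hv
    · intro u _
      simp [hP]
  suffices hn : P.natDegree ≤ 1 by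
    refine ⟨P.coeff 1, P.coeff 0, fun x => ?_⟩
    rw [← hP, eq_X_add_C_of_natDegree_le_one hn]
    simp
  by_contra! hn
  rcases Nat.lt_or_ge 1 m with hm2 | hm2
  · have claim : ∀ k, k < m → P.natDegree * k < p → P.natDegree * k < m := by
      intro k hk hkp
      by_contra! hcon
      have hd : (P ^ k).natDegree = P.natDegree * k := by rw [natDegree_pow, mul_comm]
      refine Nop_lead U m hm1 hmin hmm (P ^ k) (by omega) (by omega) ?_
      have hz : Nop U (X ^ k : (ZMod p)[X]) = 0 := by
        ext j
        rw [Nop_coeff _ _ _ (by simp; omega)]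
        rw [coeff_zero]
        refine Finset.sum_eq_zero fun i _ => ?_
        split_ifs with hi
        · rfl
        · rw [coeff_X_pow]
          split_ifs with hij
          · rw [hmin i (by omega) (by omega), mul_zero]
          · simp
      have : Nop U (P ^ k) = 0 := by
        refine poly_eq _ _ (Nop_natDegree _ _ (by omega)) (by simpa using hp.pos) fun x => ?_
        rw [key, hz]; simp
      rw [this]; simp
    have hnm : P.natDegree < m := by
      have := claim 1 hm2 (by omega)
      omega
    have hind : ∀ k, k < m → P.natDegree * k < m := by
      intro k
      induction k with
      | zero => intro _; omega
      | succ k ih =>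
        intro hk
        have := ih (by omega)
        refine claim _ hk ?_
        rw [mul_add]; omega
    have := hind (m - 1) (by omega)
    have h4 : 2 * (m - 1) ≤ P.natDegree * (m - 1) := Nat.mul_le_mul_right _ hn
    omega
  · obtain rfl : m = 1 := by omega
    refine Nop_lead U 1 hm1 hmin hmm P hPd (by omega) ?_
    have : Nop U P = C (∑ u ∈ U, u) := by
      refine poly_eq _ _ (Nop_natDegree _ _ (by omega)) (by rw [natDegree_C]; exact hp.pos) fun x => ?_
      have := key 1 x
      rw [pow_one, pow_one] at this
      rw [this, Nop_eval, eval_C]; simp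
    rw [this, coeff_C, if_neg (by omega)]

lemma burn {p : ℕ} [Fact p.Prime] (U : Finset (ZMod p)) (h0 : 0 ∉ U) (hne : U.Nonempty)
    (hU : ∃ v, v ≠ 0 ∧ v ∉ U) (π : Equiv.Perm (ZMod p))
    (h : ∀ i j, i - j ∈ U ↔ π i - π j ∈ U) : ∃ a b, ∀ x, π x = a * x + b := by
  classical
  by_cases hc : 2 * U.card < p
  · exact burn1 U h0 hne hc π h
  · obtain ⟨v, hv, hvU⟩ := hU
    refine burn1 (insert 0 U)ᶜ (by simp) ⟨v, by simp [hv, hvU]⟩ ?_ π ?_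
    · rw [Finset.card_compl, ZMod.card, Finset.card_insert_of_notMem h0]
      have : 0 < p := (Fact.out : p.Prime).pos
      omega
    · intro i j
      simp [← h, sub_eq_zero]

lemma normal_contains {q : ℕ} (hq : q.Prime) (H : Subgroup (Equiv.Perm (Fin q)))
    (hH : ∀ a b : Fin q, ∃ σ ∈ H, σ a = b) (M : Subgroup H) [M.Normal] (hM : M ≠ ⊥)
    (x : H) (hx : x ^ q = 1) : x ∈ M := by
  have : Fact q.Prime := ⟨hq⟩
  have : MulAction.IsPretransitive H (Fin q) :=
    ⟨fun a b => by obtain ⟨σ, h1, h2⟩ := hH a b; exact ⟨⟨σ, h1⟩, h2⟩⟩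
  have : MulAction.IsPreprimitive H (Fin q) := MulAction.IsPreprimitive.of_prime_card (by simpa using hq)
  have hfix : MulAction.fixedPoints M (Fin q) ≠ Set.univ := by
    intro h
    apply hM
    rw [eq_bot_iff]
    intro m hm
    rw [Subgroup.mem_bot]
    ext i
    have : i ∈ MulAction.fixedPoints M (Fin q) := h ▸ Set.mem_univ i
    have := congrArg Fin.val (this ⟨m, hm⟩)
    exact this
  have : MulAction.IsPretransitive M (Fin q) :=
    MulAction.IsQuasiPreprimitive.isPretransitive_of_normal hfix
  have hdvd : q ∣ Nat.card M := by
    have h := MulAction.index_stabilizer_of_transitive M (⟨0, hq.pos⟩ : Fin q)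
    rw [Nat.card_eq_fintype_card, Fintype.card_fin] at h
    exact h.symm.dvd.trans (Subgroup.index_dvd_card _)
  have hidx : ¬ q ∣ M.index := by
    intro h
    have h1 : q * q ∣ q.factorial := by
      have h2 : Nat.card H ∣ q.factorial := by
        have := Subgroup.card_subgroup_dvd_card H
        rwa [Nat.card_eq_fintype_card (α := Equiv.Perm (Fin q)), Fintype.card_perm, Fintype.card_fin] at this
      rw [← Subgroup.card_mul_index M] at h2
      exact (Nat.mul_dvd_mul hdvd h).trans h2
    rw [← Nat.mul_factorial_pred hq.ne_zero] at h1
    have := (hq.dvd_factorial).1 (Nat.dvd_of_mul_dvd_mul_left hq.pos h1)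
    have := hq.pos
    omega
  rw [← QuotientGroup.eq_one_iff, ← orderOf_eq_one_iff]
  have h1 : orderOf (x : H ⧸ M) ∣ q := by
    apply orderOf_dvd_of_pow_eq_one
    rw [← QuotientGroup.mk_pow, hx]; rfl
  have h2 : orderOf (x : H ⧸ M) ∣ M.index := orderOf_dvd_natCard _
  rcases (Nat.dvd_prime hq).1 h1 with h | h
  · exact h
  · rw [h] at h2; exact absurd h2 hidx

lemma coords {q : ℕ} (hq : q.Prime) (c : Equiv.Perm (Fin q)) (hc : orderOf c = q) :
    ∃ e : Fin q ≃ ZMod q, ∀ x, e (c x) = e x + 1 := by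
  obtain ⟨n, rfl⟩ : ∃ n, q = n + 2 := ⟨q - 2, by have := hq.two_le; omega⟩
  have h1 : c.IsCycle := Equiv.Perm.isCycle_of_prime_order'' (by simpa using hq) (by simpa using hc)
  have h2 := h1.isConj (isCycle_finRotate (n := n)) (by
    rw [← h1.orderOf, hc, support_finRotate, Finset.card_univ, Fintype.card_fin])
  obtain ⟨g, hg⟩ := isConj_iff.1 h2
  refine ⟨g, fun x => ?_⟩
  have := congrArg (fun f : Equiv.Perm (Fin (n+2)) => f (g x)) hg
  simp at this
  exact this

lemma translate_aux {q : ℕ} [Fact q.Prime] (f : ZMod q → ZMod q) (d : ZMod q)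
    (h : ∀ x, f (x + 1) = f x + d) (x : ZMod q) : f x = d * x + f 0 := by
  have : ∀ n : ℕ, f n = d * n + f 0 := by
    intro n
    induction n with
    | zero => simp
    | succ n ih => push_cast; rw [h, ih]; ring
  simpa using this x.val

theorem stmt_5 (q : ℕ) (hq : q.Prime) (A : Subgroup (Equiv.Perm (Fin q)))
    (hA : ∀ a b : Fin q, ∃ σ ∈ A, σ a = b) :
    (∃ e : Fin q ≃ ZMod q, ∀ σ ∈ A, ∃ a b : ZMod q, a ≠ 0 ∧
        ∀ x : ZMod q, e (σ (e.symm x)) = a * x + b) ∨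
    ((∀ a b c d : Fin q, a ≠ b → c ≠ d → ∃ σ ∈ A, σ a = c ∧ σ b = d) ∧
      ∃ B : Subgroup (Equiv.Perm (Fin q)), B ≤ A ∧
        (∀ g ∈ A, ∀ x ∈ B, g * x * g⁻¹ ∈ B) ∧
        (∃ x ∈ B, ∃ y ∈ B, x * y ≠ y * x) ∧
        IsSimpleGroup B) := by
  classical
  have : Fact q.Prime := ⟨hq⟩
  -- an element of order q
  obtain ⟨c, hcA, hc⟩ : ∃ c ∈ A, orderOf c = q := by
    have : MulAction.IsPretransitive A (Fin q) :=
      ⟨fun a b => by obtain ⟨σ, h1, h2⟩ := hA a b; exact ⟨⟨σ, h1⟩, h2⟩⟩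
    have hdvd : q ∣ Nat.card A := by
      have h := MulAction.index_stabilizer_of_transitive A (⟨0, hq.pos⟩ : Fin q)
      rw [Nat.card_eq_fintype_card, Fintype.card_fin] at h
      exact h.symm.dvd.trans (Subgroup.index_dvd_card _)
    obtain ⟨c, hc⟩ := exists_prime_orderOf_dvd_card' q hdvd
    exact ⟨c, c.2, by rwa [Subgroup.orderOf_coe]⟩
  obtain ⟨e, he⟩ := coords hq c hc
  have hes : ∀ x, c (e.symm x) = e.symm (x + 1) := by
    intro x
    rw [Equiv.eq_symm_apply, he, Equiv.apply_symm_apply]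
  -- it is enough to have affine form without the nonvanishing
  have aff : (∀ σ ∈ A, ∃ a b : ZMod q, ∀ x : ZMod q, e (σ (e.symm x)) = a * x + b) →
      (∃ e : Fin q ≃ ZMod q, ∀ σ ∈ A, ∃ a b : ZMod q, a ≠ 0 ∧
        ∀ x : ZMod q, e (σ (e.symm x)) = a * x + b) := by
    intro h
    refine ⟨e, fun σ hσ => ?_⟩
    obtain ⟨a, b, hab⟩ := h σ hσ
    refine ⟨a, b, ?_, hab⟩
    rintro rfl
    have := (hab 0).trans (by simpa using (hab 1).symm)
    simp at this
  have hcn : ∀ n : ℕ, ∀ x, e ((c ^ n) x) = e x + n := by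
    intro n
    induction n with
    | zero => simp
    | succ n ih => intro x; rw [pow_succ, Equiv.Perm.mul_apply, ih, he]; push_cast; ring
  set B : Subgroup (Equiv.Perm (Fin q)) := Subgroup.closure {σ | σ ∈ A ∧ σ ^ q = 1} with hB
  have hBA : B ≤ A := (Subgroup.closure_le _).2 fun σ hσ => hσ.1
  have hcB : c ∈ B := Subgroup.subset_closure ⟨hcA, orderOf_dvd_iff_pow_eq_one.1 hc.dvd⟩
  have hBn : ∀ g ∈ A, ∀ x ∈ B, g * x * g⁻¹ ∈ B := by
    intro g hg x hx
    induction hx using Subgroup.closure_induction with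
    | mem x hx =>
      refine Subgroup.subset_closure ⟨A.mul_mem (A.mul_mem hg hx.1) (A.inv_mem hg), ?_⟩
      rw [conj_pow, hx.2]; simp
    | one => simp
    | mul x y _ _ h1 h2 => have := B.mul_mem h1 h2; simpa [mul_assoc] using this
    | inv x _ h1 => have := B.inv_mem h1; simpa [mul_assoc] using this
  have hBt : ∀ a b : Fin q, ∃ σ ∈ B, σ a = b := by
    intro a b
    refine ⟨c ^ (e b - e a).val, B.pow_mem hcB _, ?_⟩
    apply e.injective
    rw [hcn]; simp
  have hBs : IsSimpleGroup B := by
    have : Nontrivial B := by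
      refine ⟨⟨⟨c, hcB⟩, 1, fun h => ?_⟩⟩
      have : c = 1 := congrArg Subtype.val h
      rw [this, orderOf_one] at hc
      exact hq.one_lt.ne hc
    refine ⟨fun M hM => ?_⟩
    by_cases hM0 : M = ⊥
    · exact Or.inl hM0
    right
    have hle : B ≤ M.map B.subtype := by
      refine (Subgroup.closure_le _).2 ?_
      intro σ hσ
      have hσB : σ ∈ B := Subgroup.subset_closure hσ
      refine ⟨⟨σ, hσB⟩, ?_, rfl⟩
      exact normal_contains hq B hBt M hM0 _ (Subtype.ext hσ.2)
    rw [eq_top_iff]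
    rintro ⟨x, hx⟩ -
    obtain ⟨y, hy, hyx⟩ := hle hx
    have : y = ⟨x, hx⟩ := Subtype.ext hyx
    exact this ▸ hy
  by_cases hab : ∃ x ∈ B, ∃ y ∈ B, x * y ≠ y * x
  · by_cases h2 : ∀ a b c d : Fin q, a ≠ b → c ≠ d → ∃ σ ∈ A, σ a = c ∧ σ b = d
    · exact Or.inr ⟨h2, B, hBA, hBn, hab, hBs⟩
    · left
      apply aff
      push Not at h2
      obtain ⟨a, b, c', d, hne, hne', hno⟩ := h2
      let R : Fin q → Fin q → Prop := fun i j => ∃ σ ∈ A, σ a = i ∧ σ b = j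
      have hR1 : ∀ σ ∈ A, ∀ i j, R i j → R (σ i) (σ j) := by
        rintro σ hσ i j ⟨τ, hτ, rfl, rfl⟩
        exact ⟨σ * τ, A.mul_mem hσ hτ, rfl, rfl⟩
      have hR : ∀ σ ∈ A, ∀ i j, R i j ↔ R (σ i) (σ j) := by
        intro σ hσ i j
        refine ⟨hR1 σ hσ i j, fun h => ?_⟩
        simpa using hR1 σ⁻¹ (A.inv_mem hσ) _ _ h
      let U : Finset (ZMod q) := Finset.univ.filter fun u => R (e.symm u) (e.symm 0)
      have hU : ∀ i j, i - j ∈ U ↔ R (e.symm i) (e.symm j) := by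
        intro i j
        simp only [U, Finset.mem_filter, Finset.mem_univ, true_and]
        rw [hR (c ^ j.val) (A.pow_mem hcA _)]
        have h3 : ∀ x, (c ^ j.val) (e.symm x) = e.symm (x + j) := by
          intro x
          rw [Equiv.eq_symm_apply, hcn]; simp
        rw [h3, h3]; simp
      intro σ hσ
      refine burn U ?_ ⟨e a - e b, ?_⟩ ⟨e c' - e d, ?_, ?_⟩ (e.symm.trans (σ.trans e)) ?_
      · simp only [U, Finset.mem_filter, Finset.mem_univ, true_and]
        rintro ⟨τ, _, h1, h2⟩
        exact hne (τ.injective (h1.trans h2.symm))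
      · rw [hU]; exact ⟨1, A.one_mem, by simp, by simp⟩
      · rw [sub_ne_zero]; exact fun h => hne' (e.injective h)
      · rw [hU]
        rintro ⟨τ, hτ, h1, h2⟩
        simp at h1 h2
        exact hno τ hτ h1 h2
      · intro i j
        rw [hU, hU, hR σ hσ]; simp
  · left
    apply aff
    push Not at hab
    intro σ hσ
    have hcomm := hab _ (hBn σ hσ c hcB) c hcB
    -- the conjugate of c is a translation
    have h1 : ∀ x, e ((σ * c * σ⁻¹) (e.symm x)) = x + e ((σ * c * σ⁻¹) (e.symm 0)) := by
      intro x
      have := translate_aux (fun x => e ((σ * c * σ⁻¹) (e.symm x))) 1 (fun x => ?_) x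
      · simpa using this
      · have h4 := congrArg (fun f : Equiv.Perm (Fin q) => f (e.symm x)) hcomm
        simp only [Equiv.Perm.mul_apply] at h4 ⊢
        rw [hes] at h4
        rw [h4, he]
    refine ⟨_, _, translate_aux (fun x => e (σ (e.symm x))) (e ((σ * c * σ⁻¹) (e.symm 0))) fun x => ?_⟩
    have := h1 (e (σ (e.symm x)))
    rw [← this]
    simp [hes]
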